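/- Let p ≥ 1, x, μ, α ∈ ℝ^p, Δ a symmetric positive-definite p×p matrix, ψ, χ > 0 and λ ∈ ℝ. Then for every w > 0, φ_p(x | μ + w α, w Δ) · p(w | ψ, χ, λ) = f_GH(x | λ, χ, ψ, μ, Δ, α) · p(w | ψ + αᵀΔ⁻¹α, χ + δ(x, μ | Δ), λ − p/2). In other words, in the normal mean-variance mixture representation X = μ + Wα + √W U with W ∼ GIG(ψ, χ, λ) and U ∼ N(0, Δ), the conditional distribution of W given X = x is GIG(ψ + αᵀΔ⁻¹α, χ + δ(x, μ | Δ), λ − p/2). -/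

import Mathlib

open MeasureTheory Real Matrix

/-- The modified Bessel function of the third kind (Watson's integral representation). -/
noncomputable def besselK (lam ω : ℝ) : ℝ :=
  ∫ t in Set.Ioi (0 : ℝ), Real.exp (-ω * Real.cosh t) * Real.cosh (lam * t)

/-- The GIG density in the `(ψ, χ, λ)` parameterization. -/
noncomputable def gigDensityP (ψ χ lam w : ℝ) : ℝ :=
  (ψ / χ) ^ (lam / 2) * w ^ (lam - 1) * Real.exp (-(ψ * w + χ / w) / 2)
    / (2 * besselK lam (Real.sqrt (ψ * χ)))

/-- The squared Mahalanobis distance `δ(x, μ | Δ) = (x − μ)ᵀ Δ⁻¹ (x − μ)`. -/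
noncomputable def mahalanobis {p : ℕ} (x μ : Fin p → ℝ) (Δ : Matrix (Fin p) (Fin p) ℝ) : ℝ :=
  (x - μ) ⬝ᵥ Δ⁻¹ *ᵥ (x - μ)

/-- The multivariate Gaussian density `φ_p(x | m, S)`. -/
noncomputable def gaussianDensity {p : ℕ} (x m : Fin p → ℝ) (S : Matrix (Fin p) (Fin p) ℝ) : ℝ :=
  (2 * Real.pi) ^ (-(p : ℝ) / 2) * S.det ^ (-(1 : ℝ) / 2) *
    Real.exp (-(1 / 2) * ((x - m) ⬝ᵥ S⁻¹ *ᵥ (x - m)))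

/-- The generalized hyperbolic density `f_GH(x | λ, χ, ψ, μ, Δ, α)`. -/
noncomputable def ghDensity {p : ℕ} (lam χ ψ : ℝ) (μ : Fin p → ℝ)
    (Δ : Matrix (Fin p) (Fin p) ℝ) (α : Fin p → ℝ) (x : Fin p → ℝ) : ℝ :=
  ((χ + mahalanobis x μ Δ) / (ψ + α ⬝ᵥ Δ⁻¹ *ᵥ α)) ^ ((lam - (p : ℝ) / 2) / 2)
    * (ψ / χ) ^ (lam / 2)
    * besselK (lam - (p : ℝ) / 2)
        (Real.sqrt ((ψ + α ⬝ᵥ Δ⁻¹ *ᵥ α) * (χ + mahalanobis x μ Δ)))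
    / ((2 * Real.pi) ^ ((p : ℝ) / 2) * Δ.det ^ ((1 : ℝ) / 2)
        * besselK lam (Real.sqrt (χ * ψ)) * Real.exp ((μ - x) ⬝ᵥ Δ⁻¹ *ᵥ α))

theorem integrableOn_besselK_integrand (lam : ℝ) {ω : ℝ} (hω : 0 < ω) :
    IntegrableOn (fun t => Real.exp (-ω * Real.cosh t) * Real.cosh (lam * t)) (Set.Ioi 0) := by
  have hbound : IntegrableOn
      (fun t => Real.exp ((|lam| + 1) ^ 2 / ω) * Real.exp (-t)) (Set.Ioi (0 : ℝ)) :=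
    (integrableOn_exp_neg_Ioi 0).const_mul _
  refine hbound.mono' (by fun_prop : Continuous _).aestronglyMeasurable ?_
  refine (ae_restrict_iff' measurableSet_Ioi).2 (.of_forall fun t (ht : 0 < t) => ?_)
  have hcosh_le : Real.cosh (lam * t) ≤ Real.exp (|lam| * t) := by
    rw [← Real.cosh_abs, abs_mul, abs_of_pos ht, Real.cosh_eq]
    have : Real.exp (-(|lam| * t)) ≤ Real.exp (|lam| * t) :=
      Real.exp_le_exp.2 (by linarith [mul_nonneg (abs_nonneg lam) ht.le])
    linarith
  have hcosh_ge : t ^ 2 / 4 ≤ Real.cosh t := by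
    rw [Real.cosh_eq]
    linarith [Real.quadratic_le_exp_of_nonneg ht.le, Real.exp_pos (-t)]
  have hexp : -ω * Real.cosh t + |lam| * t ≤ (|lam| + 1) ^ 2 / ω + -t := by
    have hsq : 0 ≤ (ω * t / 2 - (|lam| + 1)) ^ 2 / ω := by positivity
    have heq : (ω * t / 2 - (|lam| + 1)) ^ 2 / ω
        = ω * (t ^ 2 / 4) - (|lam| + 1) * t + (|lam| + 1) ^ 2 / ω := by
      field_simp
      ring
    linarith [mul_le_mul_of_nonneg_left hcosh_ge hω.le]
  rw [Real.norm_of_nonneg (mul_nonneg (Real.exp_pos _).le (Real.cosh_pos _).le), ← Real.exp_add]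
  calc Real.exp (-ω * Real.cosh t) * Real.cosh (lam * t)
      ≤ Real.exp (-ω * Real.cosh t) * Real.exp (|lam| * t) := by gcongr
    _ ≤ _ := by
      rw [← Real.exp_add]
      exact Real.exp_le_exp.2 hexp

theorem besselK_pos (lam : ℝ) {ω : ℝ} (hω : 0 < ω) : 0 < besselK lam ω := by
  have hpos (t : ℝ) : 0 < Real.exp (-ω * Real.cosh t) * Real.cosh (lam * t) :=
    mul_pos (Real.exp_pos _) (Real.cosh_pos _)
  rw [besselK, setIntegral_pos_iff_support_of_nonneg_ae (.of_forall fun t => (hpos t).le)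
    (integrableOn_besselK_integrand lam hω),
    Function.support_eq_univ fun t => (hpos t).ne']
  simp

/-- The Mahalanobis form of `x` about the shifted mean `μ + w α` with scale `w Δ`. -/
theorem quadForm_mean_variance {p : ℕ} (x μ α : Fin p → ℝ) {Δ : Matrix (Fin p) (Fin p) ℝ}
    (hΔ : IsUnit Δ.det) (hΔsym : Δ.IsSymm) {w : ℝ} (hw : w ≠ 0) :
    (x - (μ + w • α)) ⬝ᵥ (w • Δ)⁻¹ *ᵥ (x - (μ + w • α))
      = mahalanobis x μ Δ / w + 2 * ((μ - x) ⬝ᵥ Δ⁻¹ *ᵥ α) + w * (α ⬝ᵥ Δ⁻¹ *ᵥ α) := by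
  have hinv : (w • Δ)⁻¹ = w⁻¹ • Δ⁻¹ := by
    have := Matrix.inv_smul' Δ (Units.mk0 w hw) hΔ
    simpa [Units.smul_def] using this
  have hsymm : α ⬝ᵥ Δ⁻¹ *ᵥ (x - μ) = (x - μ) ⬝ᵥ Δ⁻¹ *ᵥ α := by
    rw [dotProduct_mulVec, ← mulVec_transpose, transpose_nonsing_inv, hΔsym.eq, dotProduct_comm]
  rw [hinv, mahalanobis, ← sub_sub, ← neg_sub x μ]
  generalize x - μ = y at *
  simp only [mulVec_sub, mulVec_smul, smul_mulVec, dotProduct_sub, sub_dotProduct, smul_dotProduct,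
    dotProduct_smul, neg_dotProduct, smul_eq_mul]
  field_simp
  linear_combination (-w) * hsymm

/-- In the normal mean-variance mixture representation `X = μ + Wα + √W U` with
`W ∼ GIG(ψ, χ, λ)` and `U ∼ N(0, Δ)`, the joint density factors so that the conditional
distribution of `W` given `X = x` is `GIG(ψ + αᵀΔ⁻¹α, χ + δ(x, μ | Δ), λ − p/2)`. -/
theorem gh_conditional_gig {p : ℕ} (hp : 1 ≤ p) (x μ α : Fin p → ℝ)
    (Δ : Matrix (Fin p) (Fin p) ℝ) (hΔ : Δ.PosDef) (hΔsym : Δ.IsSymm)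
    (ψ χ lam : ℝ) (hψ : 0 < ψ) (hχ : 0 < χ) :
    ∀ w : ℝ, 0 < w →
      gaussianDensity x (μ + w • α) (w • Δ) * gigDensityP ψ χ lam w
        = ghDensity lam χ ψ μ Δ α x
          * gigDensityP (ψ + α ⬝ᵥ Δ⁻¹ *ᵥ α) (χ + mahalanobis x μ Δ) (lam - (p : ℝ) / 2) w := by
  intro w hw
  have hdet : 0 < Δ.det := hΔ.det_pos
  have hnonneg (v : Fin p → ℝ) : 0 ≤ v ⬝ᵥ Δ⁻¹ *ᵥ v := by
    simpa using hΔ.inv.posSemidef.dotProduct_mulVec_nonneg v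
  have hψ' : 0 < ψ + α ⬝ᵥ Δ⁻¹ *ᵥ α := by linarith [hnonneg α]
  have hχ' : 0 < χ + mahalanobis x μ Δ := by
    have : 0 ≤ mahalanobis x μ Δ := hnonneg (x - μ)
    linarith
  have hquad := quadForm_mean_variance x μ α hdet.ne'.isUnit hΔsym hw.ne'
  unfold gaussianDensity gigDensityP ghDensity
  rw [hquad, det_smul, Fintype.card_fin, mul_comm χ ψ]
  generalize α ⬝ᵥ Δ⁻¹ *ᵥ α = a at *
  generalize (μ - x) ⬝ᵥ Δ⁻¹ *ᵥ α = b at *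
  generalize mahalanobis x μ Δ = d at *
  have hK := besselK_pos (lam - p / 2) (Real.sqrt_pos.2 (mul_pos hψ' hχ'))
  have hK' := besselK_pos lam (Real.sqrt_pos.2 (mul_pos hψ hχ))
  generalize besselK (lam - p / 2) _ = K at *
  generalize besselK lam _ = K' at *
  have hratio : ((ψ + a) / (χ + d)) ^ ((lam - (p : ℝ) / 2) / 2)
      = (((χ + d) / (ψ + a)) ^ ((lam - (p : ℝ) / 2) / 2))⁻¹ := by
    rw [← Real.inv_rpow (by positivity), inv_div]
  have hpi : (2 * Real.pi) ^ (-(p : ℝ) / 2) = ((2 * Real.pi) ^ ((p : ℝ) / 2))⁻¹ := by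
    rw [neg_div, Real.rpow_neg (by positivity)]
  have hdetpow : (w ^ p * Δ.det) ^ (-(1 : ℝ) / 2)
      = (w ^ ((p : ℝ) / 2))⁻¹ * (Δ.det ^ ((1 : ℝ) / 2))⁻¹ := by
    rw [Real.mul_rpow (by positivity) hdet.le, neg_div, Real.rpow_neg (by positivity),
      Real.rpow_neg hdet.le, ← Real.rpow_natCast, ← Real.rpow_mul hw.le, mul_one_div]
  have hwpow : w ^ (lam - (p : ℝ) / 2 - 1) = w ^ (lam - 1) * (w ^ ((p : ℝ) / 2))⁻¹ := by
    rw [← Real.rpow_neg hw.le, ← Real.rpow_add hw]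
    ring_nf
  have hexp : Real.exp (-(1 / 2) * (d / w + 2 * b + w * a)) * Real.exp (-(ψ * w + χ / w) / 2)
      = (Real.exp b)⁻¹ * Real.exp (-((ψ + a) * w + (χ + d) / w) / 2) := by
    rw [← Real.exp_neg, ← Real.exp_add, ← Real.exp_add]
    ring_nf
  rw [hratio, hpi, hdetpow, hwpow]
  have hR : 0 < ((χ + d) / (ψ + a)) ^ ((lam - (p : ℝ) / 2) / 2) := by positivity
  generalize ((χ + d) / (ψ + a)) ^ ((lam - (p : ℝ) / 2) / 2) = R at *
  generalize Real.exp (-(1 / 2) * (d / w + 2 * b + w * a)) = E₁ at *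
  generalize Real.exp (-(ψ * w + χ / w) / 2) = E₂ at *
  generalize Real.exp (-((ψ + a) * w + (χ + d) / w) / 2) = E₃ at *
  calc _ = ((2 * Real.pi) ^ ((p : ℝ) / 2))⁻¹ * ((w ^ ((p : ℝ) / 2))⁻¹ * (Δ.det ^ ((1 : ℝ) / 2))⁻¹)
        * ((ψ / χ) ^ (lam / 2) * w ^ (lam - 1)) / (2 * K') * (E₁ * E₂) := by ring
    _ = _ := by
      rw [hexp]
      field_simp
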